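/- Define Φ : ℝ⁵ → ℝ⁵ by Φ(x, y, z, z₁, z₂) = ( (1/2)(z − z₂) e^{x}, ( x z₂ − z₁ − (x−1) z ) e^{x}, (1/8)( z₂(z₂ + 2z) − 3z² + 4 z₁ z₂ − 2y ), −(1/2)(z₂ + 2 z₁ + z) e^{−x}, e^{−2x} ). Then the fifth coordinate of Φ(p) is positive for every p ∈ ℝ⁵, and the pullback along DΦ(p) of each of the three 1-forms of the Monge equation y' = ln(z'') (i.e. f = ln z₂, on z₂ > 0) at Φ(p) lies in the linear span of the three 1-forms of the Monge equation y' = (z'')² + 2(z')² + z² at p. That is, Φ maps the Monge equation y' = (z'')² + 2(z')² + z² to y' = ln(z''). -/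

import Mathlib

open Real

/-- The `i`-th coordinate projection on `ℝ⁵`, as a continuous linear map. -/
noncomputable def pr (i : Fin 5) : (Fin 5 → ℝ) →L[ℝ] ℝ :=
  ContinuousLinearMap.proj i

/-- The three 1-forms `dy - f dx`, `dz - z₁ dx`, `dz₁ - z₂ dx` at the point `p`
encoding the Monge equation `y' = f(z, z', z'')` on `ℝ⁵` with coordinates
`(x, y, z, z₁, z₂) = (p 0, p 1, p 2, p 3, p 4)`. -/
noncomputable def mongeForms (f : (Fin 5 → ℝ) → ℝ) (p : Fin 5 → ℝ) :
    Fin 3 → ((Fin 5 → ℝ) →L[ℝ] ℝ) :=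
  ![pr 1 - f p • pr 0, pr 2 - p 3 • pr 0, pr 3 - p 4 • pr 0]

/-- The equivalence `Φ`. -/
noncomputable def Phi : (Fin 5 → ℝ) → (Fin 5 → ℝ) :=
  fun p =>
    ![(1 / 2) * (p 2 - p 4) * Real.exp (p 0),
      (p 0 * p 4 - p 3 - (p 0 - 1) * p 2) * Real.exp (p 0),
      (1 / 8) * (p 4 * (p 4 + 2 * p 2) - 3 * p 2 ^ 2 + 4 * p 3 * p 4 - 2 * p 1),
      -(1 / 2) * (p 4 + 2 * p 3 + p 2) * Real.exp (-p 0),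
      Real.exp (-2 * p 0)]

/-- The derivative of `Phi` at `p`, given by the differentials of its coordinates. -/
noncomputable def PhiDeriv (p : Fin 5 → ℝ) : (Fin 5 → ℝ) →L[ℝ] (Fin 5 → ℝ) :=
  ContinuousLinearMap.pi
    ![(Real.exp (p 0) / 2) • (pr 2 - pr 4 + (p 2 - p 4) • pr 0),
      Real.exp (p 0) • (p 0 • pr 4 - pr 3 - (p 0 - 1) • pr 2 +
        (p 4 + p 0 * p 4 - p 3 - p 0 * p 2) • pr 0),
      (1 / 8 : ℝ) • ((2 * p 4 + 2 * p 2 + 4 * p 3) • pr 4 + (2 * p 4 - 6 * p 2) • pr 2 +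
        (4 * p 4) • pr 3 - (2 : ℝ) • pr 1),
      (-(Real.exp (-p 0) / 2)) • (pr 4 + (2 : ℝ) • pr 3 + pr 2 -
        (p 4 + 2 * p 3 + p 2) • pr 0),
      (-2 * Real.exp (-2 * p 0)) • pr 0]

lemma hasFDerivAt_coord (i : Fin 5) (p : Fin 5 → ℝ) :
    HasFDerivAt (fun q : Fin 5 → ℝ => q i) (pr i) p :=
  (pr i).hasFDerivAt

lemma pr_apply (i : Fin 5) (v : Fin 5 → ℝ) : pr i v = v i := rfl

lemma hasFDerivAt_Phi (p : Fin 5 → ℝ) : HasFDerivAt Phi (PhiDeriv p) p := by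
  have h := fun i => hasFDerivAt_coord i p
  rw [hasFDerivAt_pi']
  intro i
  fin_cases i
  · refine ((((h 2).sub (h 4)).const_mul (1 / 2)).mul (h 0).exp).congr_fderiv ?_
    ext v
    simp [PhiDeriv, pr_apply]
    ring
  · refine (((((h 0).mul (h 4)).sub (h 3)).sub
      (((h 0).sub_const 1).mul (h 2))).mul (h 0).exp).congr_fderiv ?_
    ext v
    simp [PhiDeriv, pr_apply]
    ring
  · refine ((((((h 4).mul ((h 4).add ((h 2).const_mul 2))).sub
      (((h 2).pow 2).const_mul 3)).add (((h 3).const_mul 4).mul (h 4))).sub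
      ((h 1).const_mul 2)).const_mul (1 / 8)).congr_fderiv ?_
    ext v
    simp [PhiDeriv, pr_apply]
    ring
  · refine (((((h 4).add ((h 3).const_mul 2)).add (h 2)).const_mul (-(1 / 2))).mul
      (h 0).neg.exp).congr_fderiv ?_
    ext v
    simp [PhiDeriv, pr_apply]
    ring
  · refine ((h 0).const_mul (-2)).exp.congr_fderiv ?_
    ext v
    simp [PhiDeriv, pr_apply]
    ring

lemma linearCombination_mem_span_mongeForms (f : (Fin 5 → ℝ) → ℝ) (p : Fin 5 → ℝ)
    (c : Fin 3 → ℝ) :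
    ∑ j, c j • mongeForms f p j ∈ Submodule.span ℝ (Set.range (mongeForms f p)) :=
  Submodule.sum_mem _ fun j _ =>
    Submodule.smul_mem _ _ (Submodule.subset_span (Set.mem_range_self j))

/-- The map `Φ` maps the Monge equation `y' = (z'')² + 2(z')² + z²` to
`y' = ln(z'')`: its fifth coordinate is everywhere positive and the pullback
along `DΦ(p)` of each 1-form of `y' = ln(z'')` at `Φ(p)` lies in the span of the
1-forms of `y' = (z'')² + 2(z')² + z²` at `p`. -/
theorem Phi_equivalence (p : Fin 5 → ℝ) :
    Phi p 4 > 0 ∧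
    ∀ i : Fin 3,
      ((mongeForms (fun q => Real.log (q 4)) (Phi p) i).comp (fderiv ℝ Phi p)) ∈
        Submodule.span ℝ (Set.range (mongeForms
          (fun q => q 4 ^ 2 + 2 * q 3 ^ 2 + q 2 ^ 2) p)) := by
  refine ⟨Real.exp_pos _, fun i => ?_⟩
  rw [(hasFDerivAt_Phi p).fderiv]
  have hexp : Real.exp (-2 * p 0) * Real.exp (p 0) = Real.exp (-p 0) := by
    rw [← Real.exp_add]
    ring_nf
  fin_cases i
  · convert linearCombination_mem_span_mongeForms _ p ![0, Real.exp (p 0), -Real.exp (p 0)] using 1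
    ext v
    simp [mongeForms, Phi, PhiDeriv, pr_apply, Fin.sum_univ_three]
    ring
  · have hinv : Real.exp (-p 0) * Real.exp (p 0) = 1 := by
      rw [← Real.exp_add, neg_add_cancel, Real.exp_zero]
    convert linearCombination_mem_span_mongeForms _ p
      ![-(1 / 4), (p 4 - p 2 + p 3) / 2, p 4 / 2] using 1
    ext v
    simp [-one_div, mongeForms, Phi, PhiDeriv, pr_apply, Fin.sum_univ_three]
    linear_combination (1 / 4) * (p 4 + 2 * p 3 + p 2) *
      (v 2 - v 4 + (p 2 - p 4) * v 0) * hinv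
  · convert linearCombination_mem_span_mongeForms _ p
      ![0, -Real.exp (-p 0), -Real.exp (-p 0)] using 1
    ext v
    simp [-neg_mul, mongeForms, Phi, PhiDeriv, pr_apply, Fin.sum_univ_three]
    linear_combination (-(1 / 2)) * (v 2 - v 4 + (p 2 - p 4) * v 0) * hexp
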